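/- (Nonexistence of equivariant maps from Δ_{r,2r-1} to the sphere.) Let r be a prime power. Then there is no continuous S_r-equivariant map from the configuration space C₂ to the sphere S^{r-2}, where S^{r-2} = {y : Fin r → ℝ | ∑ i, y i = 0 ∧ ‖y‖ = 1} with S_r acting by permuting coordinates ((σ·y) i = y (σ⁻¹ i)), and equivariance means f(σ·M) = σ·f(M) for all σ ∈ S_r and M ∈ C₂. -/

import Mathlib

/-- The configuration space `C₂`, the geometric realization of the chessboard
complex `Δ_{r,2r-1}`: matrices with nonnegative entries summing to `1`,
at most one nonzero entry in each row, and at most one nonzero entry in each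
column. -/
def ConfC2 (r : ℕ) : Set (Fin r → Fin (2 * r - 1) → ℝ) :=
  {M | (∀ b t, 0 ≤ M b t) ∧ (∑ b, ∑ t, M b t) = 1 ∧
    (∀ b t t', M b t ≠ 0 → M b t' ≠ 0 → t = t') ∧
    (∀ t b b', M b t ≠ 0 → M b' t ≠ 0 → b = b')}

/-- The action of `σ ∈ S_r` on configuration spaces of matrices,
permuting the rows (boxes). -/
def rowPerm {r m : ℕ} (σ : Equiv.Perm (Fin r)) (M : Fin r → Fin m → ℝ) :
    Fin r → Fin m → ℝ :=
  fun b t => M (σ⁻¹ b) t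

namespace ListChain

variable {X Y : Type*}

/-- Prepend the vertex `a` to every ordered simplex of a chain. -/
noncomputable def cone (a : X) : (List X →₀ ℤ) →ₗ[ℤ] (List X →₀ ℤ) :=
  Finsupp.lmapDomain ℤ ℤ (List.cons a)

/-- The augmented simplicial boundary of an ordered simplex. -/
noncomputable def boundaryList : List X → (List X →₀ ℤ)
  | [] => 0
  | a :: l => Finsupp.single l 1 - cone a (boundaryList l)

/-- The augmented simplicial boundary operator on ordered chains. -/
noncomputable def boundary : (List X →₀ ℤ) →ₗ[ℤ] (List X →₀ ℤ) :=
  Finsupp.linearCombination ℤ boundaryList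

/-- Auxiliary recursion for `subdivision`, on simplices with `n` vertices. -/
noncomputable def subdivisionAux (b : List X → Y) : ℕ → (List X →₀ ℤ) →ₗ[ℤ] (List Y →₀ ℤ)
  | 0 => Finsupp.linearCombination ℤ fun _ => Finsupp.single [] 1
  | n + 1 => Finsupp.linearCombination ℤ fun l => cone (b l) (subdivisionAux b n (boundaryList l))

/-- The barycentric subdivision operator, in which the barycenter of each nonempty ordered
simplex `l` is replaced by `b l`. -/
noncomputable def subdivision (b : List X → Y) : (List X →₀ ℤ) →ₗ[ℤ] (List Y →₀ ℤ) :=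
  Finsupp.linearCombination ℤ fun l => subdivisionAux b l.length (Finsupp.single l 1)

theorem map_mem_supported (L : (List X →₀ ℤ) →ₗ[ℤ] (List Y →₀ ℤ)) {s : Set (List X)}
    {t : Set (List Y)} (h : ∀ l ∈ s, L (Finsupp.single l 1) ∈ Finsupp.supported ℤ ℤ t)
    {x : List X →₀ ℤ} (hx : x ∈ Finsupp.supported ℤ ℤ s) :
    L x ∈ Finsupp.supported ℤ ℤ t := by
  rw [Finsupp.supported_eq_span_single] at hx
  induction hx using Submodule.span_induction with
  | mem x hx => obtain ⟨l, hl, rfl⟩ := hx; exact h l hl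
  | zero => simp
  | add x y _ _ hx hy => rw [map_add]; exact Submodule.add_mem _ hx hy
  | smul c x _ hx => rw [map_smul]; exact Submodule.smul_mem _ c hx

theorem eq_of_mem_supported {M : Type*} [AddCommGroup M] (L L' : (List X →₀ ℤ) →ₗ[ℤ] M)
    {s : Set (List X)} (h : ∀ l ∈ s, L (Finsupp.single l 1) = L' (Finsupp.single l 1))
    {x : List X →₀ ℤ} (hx : x ∈ Finsupp.supported ℤ ℤ s) : L x = L' x := by
  rw [Finsupp.supported_eq_span_single] at hx
  induction hx using Submodule.span_induction with
  | mem x hx => obtain ⟨l, hl, rfl⟩ := hx; exact h l hl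
  | zero => simp
  | add x y _ _ hx hy => rw [map_add, map_add, hx, hy]
  | smul c x _ hx => rw [map_smul, map_smul, hx]

theorem supported_mono {s t : Set (List X)} (h : s ⊆ t) {x : List X →₀ ℤ}
    (hx : x ∈ Finsupp.supported ℤ ℤ s) : x ∈ Finsupp.supported ℤ ℤ t :=
  Finsupp.supported_mono h hx

@[simp] theorem cone_single (a : X) (l : List X) (c : ℤ) :
    cone a (Finsupp.single l c) = Finsupp.single (a :: l) c := by
  simp [cone]

@[simp] theorem cone_apply_cons (a : X) (x : List X →₀ ℤ) (l : List X) :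
    cone a x (a :: l) = x l :=
  Finsupp.mapDomain_apply (List.cons_injective) x l

theorem cone_apply_of_ne {a : X} (x : List X →₀ ℤ) {F : List X} (h : ∀ l, F ≠ a :: l) :
    cone a x F = 0 :=
  Finsupp.mapDomain_of_notMem_range _ _ (by rintro ⟨l, rfl⟩; exact h l rfl)

@[simp] theorem boundary_single (l : List X) :
    boundary (Finsupp.single l 1) = boundaryList l := by
  simp [boundary]

theorem boundary_cone (a : X) (x : List X →₀ ℤ) :
    boundary (cone a x) = x - cone a (boundary x) := by
  have : boundary ∘ₗ cone a = LinearMap.id - cone a ∘ₗ boundary := by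
    ext l : 2
    simp [boundaryList]
  exact LinearMap.congr_fun this x

theorem boundary_boundaryList (l : List X) : boundary (boundaryList l) = 0 := by
  induction l with
  | nil => simp [boundaryList]
  | cons a l ih => simp [boundaryList, boundary_cone, ih]

theorem boundaryList_mem (l : List X) :
    boundaryList l ∈ Finsupp.supported ℤ ℤ {m | m.length + 1 = l.length ∧ m.Sublist l} := by
  induction l with
  | nil => exact Submodule.zero_mem _
  | cons a l ih =>
    refine Submodule.sub_mem _ (Finsupp.single_mem_supported _ _ (by simp)) ?_
    refine map_mem_supported (cone a) (fun m hm => ?_) ih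
    rw [cone_single]
    exact Finsupp.single_mem_supported _ _ ⟨by simp [hm.1], hm.2.cons_cons a⟩

@[simp] theorem subdivision_single_nil (b : List X → Y) :
    subdivision b (Finsupp.single [] 1) = Finsupp.single [] 1 := by
  simp [subdivision, subdivisionAux]

theorem subdivision_single (b : List X → Y) {l : List X} (hl : l ≠ []) :
    subdivision b (Finsupp.single l 1) = cone (b l) (subdivision b (boundaryList l)) := by
  obtain ⟨a, l, rfl⟩ := List.exists_cons_of_ne_nil hl
  have : subdivisionAux b l.length (boundaryList (a :: l)) =
      subdivision b (boundaryList (a :: l)) := by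
    refine eq_of_mem_supported _ _ (fun m hm => ?_) (boundaryList_mem (a :: l))
    have : m.length = l.length := by simpa using hm.1
    simp [subdivision, this]
  simp [subdivision, subdivisionAux] at this ⊢
  rw [this]

theorem boundary_subdivision (b : List X → Y) (x : List X →₀ ℤ) :
    boundary (subdivision b x) = subdivision b (boundary x) := by
  have key : ∀ n : ℕ, ∀ l : List X, l.length = n →
      boundary (subdivision b (Finsupp.single l 1)) = subdivision b (boundaryList l) := by
    intro n
    induction n with
    | zero =>
      intro l hl
      obtain rfl := List.length_eq_zero_iff.1 hl
      simp [boundaryList]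
    | succ n ih =>
      intro l hl
      have hne : l ≠ [] := by rintro rfl; simp at hl
      rw [subdivision_single b hne, boundary_cone]
      have : (boundary ∘ₗ subdivision b) (boundaryList l) =
          (subdivision b ∘ₗ boundary) (boundaryList l) :=
        eq_of_mem_supported _ _ (fun m hm => by
          simpa using ih m (by have := hm.1; omega)) (boundaryList_mem l)
      simp only [LinearMap.comp_apply, boundary_boundaryList, map_zero] at this
      simp [this]
  have : boundary ∘ₗ subdivision b = subdivision b ∘ₗ boundary := by
    ext l : 2
    simpa using key _ l rfl
  exact LinearMap.congr_fun this x

/-- The simplices of the subdivision of `l`: their vertices are `b k` for a decreasing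
sequence of sublists `k` of `l`. -/
theorem subdivision_single_mem (b : List X → Y) (l : List X) :
    subdivision b (Finsupp.single l 1) ∈ Finsupp.supported ℤ ℤ {m | m.length = l.length ∧
      (∀ y ∈ m, ∃ k, k ≠ [] ∧ k.Sublist l ∧ b k = y) ∧
      m.Pairwise fun y y' => ∃ k k', k ≠ [] ∧ k' ≠ [] ∧ k'.Sublist k ∧ k.Sublist l ∧
        b k = y ∧ b k' = y'} := by
  induction hn : l.length generalizing l with
  | zero =>
    obtain rfl := List.length_eq_zero_iff.1 hn
    rw [subdivision_single_nil]
    exact Finsupp.single_mem_supported _ _ (by simp)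
  | succ n ih =>
    have hne : l ≠ [] := by rintro rfl; simp at hn
    rw [subdivision_single b hne]
    refine map_mem_supported (s := {m | m.length = n ∧
      (∀ y ∈ m, ∃ k, k ≠ [] ∧ k.Sublist l ∧ b k = y) ∧
      m.Pairwise fun y y' => ∃ k k', k ≠ [] ∧ k' ≠ [] ∧ k'.Sublist k ∧ k.Sublist l ∧
        b k = y ∧ b k' = y'}) _ (fun m hm => ?_) ?_
    · rw [cone_single]
      refine Finsupp.single_mem_supported _ _ ⟨by simp [hm.1], ?_, ?_⟩
      · rintro y hy
        rcases List.mem_cons.1 hy with rfl | hy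
        · exact ⟨l, hne, List.Sublist.refl l, rfl⟩
        · exact hm.2.1 y hy
      · refine List.pairwise_cons.2 ⟨fun y hy => ?_, hm.2.2⟩
        obtain ⟨k, hk, hkl, rfl⟩ := hm.2.1 y hy
        exact ⟨l, k, hne, hk, hkl, List.Sublist.refl l, rfl, rfl⟩
    · refine map_mem_supported _ (fun m hm => ?_) (boundaryList_mem l)
      refine supported_mono ?_ (ih m (by have := hm.1; omega))
      rintro q ⟨h1, h2, h3⟩
      refine ⟨h1, fun y hy => ?_, h3.imp ?_⟩
      · obtain ⟨k, hk, hkl, rfl⟩ := h2 y hy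
        exact ⟨k, hk, hkl.trans hm.2, rfl⟩
      · rintro y y' ⟨k, k', a1, a2, a3, a4, a5⟩
        exact ⟨k, k', a1, a2, a3, a4.trans hm.2, a5⟩

theorem subdivision_single_congr {b b' : List X → Y} {l : List X}
    (h : ∀ k, k ≠ [] → k.Sublist l → b k = b' k) :
    subdivision b (Finsupp.single l 1) = subdivision b' (Finsupp.single l 1) := by
  induction hn : l.length generalizing l with
  | zero =>
    obtain rfl := List.length_eq_zero_iff.1 hn
    simp
  | succ n ih =>
    have hne : l ≠ [] := by rintro rfl; simp at hn
    rw [subdivision_single b hne, subdivision_single b' hne, h l hne (List.Sublist.refl l)]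
    congr 1
    exact eq_of_mem_supported _ _ (fun m hm => ih
      (fun k hk hkm => h k hk (hkm.trans hm.2)) (by have := hm.1; omega)) (boundaryList_mem l)

/-- The boundary of a degenerate sorted simplex has no nondegenerate terms. -/
theorem boundaryList_apply_eq_zero [PartialOrder X] {G F : List X}
    (hG : G.Pairwise (· ≥ ·)) (hG' : ¬ G.Pairwise (· > ·)) (hF : F.Pairwise (· > ·)) :
    boundaryList G F = 0 := by
  induction G generalizing F with
  | nil => exact absurd List.Pairwise.nil hG'
  | cons a G ih =>
    rw [List.pairwise_cons] at hG
    by_cases hs : G.Pairwise (· > ·)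
    · obtain ⟨c, G, rfl⟩ : ∃ c G', G = c :: G' := by
        refine List.exists_cons_of_ne_nil ?_
        rintro rfl
        exact hG' (List.pairwise_singleton _ _)
      have hac : a = c := by
        by_contra hne
        apply hG'
        have hlt : a > c := lt_of_le_of_ne (hG.1 c (by simp)) (Ne.symm hne)
        refine List.pairwise_cons.2 ⟨fun y hy => ?_, hs⟩
        rcases List.mem_cons.1 hy with rfl | hy
        · exact hlt
        · exact lt_trans ((List.pairwise_cons.1 hs).1 y hy) hlt
      subst hac
      have : cone a (cone a (boundaryList G)) F = 0 := by
        by_cases h : ∃ l, F = a :: a :: l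
        · obtain ⟨l, rfl⟩ := h
          exact absurd ((List.pairwise_cons.1 hF).1 a (by simp)) (lt_irrefl a)
        · by_cases h' : ∃ l, F = a :: l
          · obtain ⟨l, rfl⟩ := h'
            rw [cone_apply_cons, cone_apply_of_ne]
            rintro m rfl
            exact h ⟨m, rfl⟩
          · rw [cone_apply_of_ne]
            rintro m rfl
            exact h' ⟨m, rfl⟩
      simp [boundaryList, this]
    · have h1 : (Finsupp.single G (1 : ℤ)) F = 0 :=
        Finsupp.single_eq_of_ne (by rintro rfl; exact hs hF)
      have h2 : cone a (boundaryList G) F = 0 := by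
        by_cases h' : ∃ l, F = a :: l
        · obtain ⟨l, rfl⟩ := h'
          rw [cone_apply_cons]
          exact ih hG.2 hs (List.pairwise_cons.1 hF).2
        · rw [cone_apply_of_ne]
          rintro m rfl
          exact h' ⟨m, rfl⟩
      simp [boundaryList, h1, h2]

theorem apply_eq_sum (L : (List X →₀ ℤ) →ₗ[ℤ] (List Y →₀ ℤ)) (s : Finset (List X))
    (x : List X →₀ ℤ) (F : List Y)
    (h : ∀ G ∈ x.support, G ∉ s → L (Finsupp.single G 1) F = 0) :
    L x F = ∑ G ∈ s, x G * L (Finsupp.single G 1) F := by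
  classical
  have hx : L x F = ∑ G ∈ x.support, x G * L (Finsupp.single G 1) F := by
    conv_lhs => rw [← Finsupp.sum_single x, Finsupp.sum, map_sum, Finsupp.finsetSum_apply]
    refine Finset.sum_congr rfl fun G _ => ?_
    rw [← smul_eq_mul, ← Finsupp.smul_apply, ← map_smul, Finsupp.smul_single, smul_eq_mul, mul_one]
  rw [hx, ← Finset.sum_subset (Finset.inter_subset_left : x.support ∩ s ⊆ _),
    ← Finset.sum_subset (Finset.inter_subset_right : x.support ∩ s ⊆ _)]
  · intro G hG hG'
    have : G ∉ x.support := fun h' => hG' (Finset.mem_inter.2 ⟨h', hG⟩)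
    rw [Finsupp.notMem_support_iff.1 this, zero_mul]
  · intro G hG hG'
    rw [h G hG fun h' => hG' (Finset.mem_inter.2 ⟨hG, h'⟩), mul_zero]

/-- Hopf trace formula: an operator that is null-homotopic on the augmented chain complex of
an order complex has vanishing Lefschetz number. -/
theorem sum_trace_eq_zero [PartialOrder X] (Q : Set X) (𝓕 : Finset (List X))
    (h𝓕 : ∀ F, F ∈ 𝓕 ↔ F.Pairwise (· > ·) ∧ ∀ a ∈ F, a ∈ Q)
    (T K : (List X →₀ ℤ) →ₗ[ℤ] (List X →₀ ℤ))
    (hT : ∀ F ∈ 𝓕, T (Finsupp.single F 1) =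
      boundary (K (Finsupp.single F 1)) + K (boundaryList F))
    (hK : ∀ F ∈ 𝓕, K (Finsupp.single F 1) ∈
      Finsupp.supported ℤ ℤ {G | G.Pairwise (· ≥ ·) ∧ ∀ a ∈ G, a ∈ Q}) :
    ∑ F ∈ 𝓕, (-1) ^ F.length * T (Finsupp.single F 1) F = 0 := by
  have e1 : ∀ F ∈ 𝓕, boundary (K (Finsupp.single F 1)) F =
      ∑ G ∈ 𝓕, K (Finsupp.single F 1) G * boundaryList G F := by
    intro F hF
    rw [apply_eq_sum boundary 𝓕]
    · simp
    · intro G hG hG'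
      have := (Finsupp.mem_supported _ _).1 (hK F hF) hG
      rw [boundary_single]
      refine boundaryList_apply_eq_zero this.1 (fun h => hG' ?_) ((h𝓕 F).1 hF).1
      exact (h𝓕 G).2 ⟨h, this.2⟩
  have e2 : ∀ F ∈ 𝓕, K (boundaryList F) F =
      ∑ G ∈ 𝓕, boundaryList F G * K (Finsupp.single G 1) F := by
    intro F hF
    rw [apply_eq_sum K 𝓕]
    intro G hG hG'
    have := (Finsupp.mem_supported _ _).1 (boundaryList_mem F) hG
    refine absurd ((h𝓕 G).2 ⟨?_, ?_⟩) hG'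
    · exact ((h𝓕 F).1 hF).1.sublist this.2
    · exact fun a ha => ((h𝓕 F).1 hF).2 a (this.2.subset ha)
  have e3 : ∀ F ∈ 𝓕, (-1) ^ F.length * T (Finsupp.single F 1) F =
      (∑ G ∈ 𝓕, (-1) ^ F.length * (K (Finsupp.single F 1) G * boundaryList G F)) +
      ∑ G ∈ 𝓕, (-1) ^ F.length * (boundaryList F G * K (Finsupp.single G 1) F) := by
    intro F hF
    rw [hT F hF, Finsupp.add_apply, e1 F hF, e2 F hF, mul_add, Finset.mul_sum, Finset.mul_sum]
  rw [Finset.sum_congr rfl e3, Finset.sum_add_distrib,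
    Finset.sum_comm (f := fun F G => (-1) ^ F.length *
      (boundaryList F G * K (Finsupp.single G 1) F)), ← Finset.sum_add_distrib]
  refine Finset.sum_eq_zero fun F _ => ?_
  rw [← Finset.sum_add_distrib]
  refine Finset.sum_eq_zero fun G _ => ?_
  by_cases h : boundaryList G F = 0
  · simp [h]
  · have := ((Finsupp.mem_supported _ _).1 (boundaryList_mem G)
      (Finsupp.mem_support_iff.2 h)).1
    rw [← this, pow_succ]
    ring

end ListChain

section Geometry

variable {E : Type*} [NormedAddCommGroup E] [NormedSpace ℝ E]

/-- The centroid of a nonempty list of points. -/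
noncomputable def listCenter (l : List E) : E := (l.length : ℝ)⁻¹ • l.sum

theorem listCenter_eq (l : List E) :
    listCenter l = ∑ i : Fin l.length, (l.length : ℝ)⁻¹ • l[i] := by
  rw [← Finset.smul_sum, listCenter]
  congr 1
  exact (Fin.sum_univ_getElem l).symm

theorem listCenter_mem {C : Set E} (hC : Convex ℝ C) {l : List E} (hl : l ≠ [])
    (h : ∀ v ∈ l, v ∈ C) : listCenter l ∈ C := by
  have : (l.length : ℝ) ≠ 0 := by simpa using hl
  rw [listCenter_eq]
  refine hC.sum_mem (fun _ _ => by positivity) ?_ fun i _ => h _ (List.getElem_mem _)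
  simp [this]

theorem dist_listCenter_le {l : List E} {d : ℝ} (h : ∀ v ∈ l, ∀ w ∈ l, dist v w ≤ d)
    {w : E} (hw : w ∈ l) : dist (listCenter l) w ≤ (1 - 1 / (l.length : ℝ)) * d := by
  obtain ⟨j, hj, rfl⟩ := List.mem_iff_getElem.1 hw
  have hpos : (0 : ℝ) < l.length := by exact_mod_cast (by omega : 0 < l.length)
  have e : listCenter l - l[j] = (l.length : ℝ)⁻¹ • ∑ i : Fin l.length, (l[i] - l[j]) := by
    rw [Finset.sum_sub_distrib, smul_sub, listCenter_eq, Finset.smul_sum]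
    simp only [Finset.sum_const, Finset.card_univ, Fintype.card_fin]
    rw [← Nat.cast_smul_eq_nsmul ℝ, smul_smul, inv_mul_cancel₀ hpos.ne', one_smul]
  have hs : ‖∑ i : Fin l.length, (l[i] - l[j])‖ ≤ (l.length - 1) * d := by
    rw [← Finset.sum_erase (a := (⟨j, hj⟩ : Fin l.length)) _ (by simp)]
    refine (norm_sum_le_of_le (n := fun _ => d) _ fun i _ => ?_).trans ?_
    · rw [← dist_eq_norm]
      exact h _ (List.getElem_mem _) _ hw
    · rw [Finset.sum_const, Finset.card_erase_of_mem (Finset.mem_univ _), Finset.card_univ,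
        Fintype.card_fin, nsmul_eq_mul, Nat.cast_sub (by omega), Nat.cast_one]
  rw [dist_eq_norm, e, norm_smul, Real.norm_of_nonneg (by positivity)]
  calc (l.length : ℝ)⁻¹ * _ ≤ (l.length : ℝ)⁻¹ * ((l.length - 1) * d) := by gcongr
    _ = _ := by field_simp

/-- Barycentric subdivision preserves convex sets and shrinks the mesh. -/
theorem subdivision_listCenter_mem {C : Set E} (hC : Convex ℝ C) {N : ℕ} {d : ℝ} {l : List E}
    (hN : l.length ≤ N) (hl : ∀ v ∈ l, v ∈ C) (hd : ∀ v ∈ l, ∀ w ∈ l, dist v w ≤ d) :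
    ListChain.subdivision listCenter (Finsupp.single l 1) ∈
      Finsupp.supported ℤ ℤ {m | m.length = l.length ∧ (∀ v ∈ m, v ∈ C) ∧
        ∀ v ∈ m, ∀ w ∈ m, dist v w ≤ (1 - 1 / (N : ℝ)) * d} := by
  refine ListChain.supported_mono ?_ (ListChain.subdivision_single_mem listCenter l)
  rintro m ⟨h1, h2, h3⟩
  refine ⟨h1, fun v hv => ?_, ?_⟩
  · obtain ⟨k, hk, hkl, rfl⟩ := h2 v hv
    exact listCenter_mem hC hk fun v hv => hl v (hkl.subset hv)
  · intro v hv
    have hlne : l ≠ [] := by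
      rintro rfl
      rw [List.length_eq_zero_iff.1 h1] at hv
      simp at hv
    have hd0 : 0 ≤ d := by
      obtain ⟨a, ha⟩ := List.exists_mem_of_ne_nil l hlne
      exact dist_nonneg.trans (hd a ha a ha)
    have hN0 : 1 ≤ N := (List.length_pos_iff.2 hlne).trans_le hN
    have hnn : 0 ≤ (1 - 1 / (N : ℝ)) * d := by
      have : 1 / (N : ℝ) ≤ 1 := by
        rw [div_le_one (by positivity)]
        exact_mod_cast hN0
      exact mul_nonneg (by linarith) hd0
    intro w hw
    have : Std.Symm fun v w : E => dist v w ≤ (1 - 1 / (N : ℝ)) * d :=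
      ⟨fun x y h => by rwa [dist_comm]⟩
    refine List.Pairwise.forall_of_forall (R := fun v w => dist v w ≤ (1 - 1 / (N : ℝ)) * d)
      (fun x _ => by simpa using hnn) (h3.imp ?_) hv hw
    rintro _ _ ⟨k, k', hk, hk', hkk, hkl, rfl, rfl⟩
    rw [dist_comm]
    refine listCenter_mem (convex_closedBall (listCenter k) _) hk' fun v hv => ?_
    rw [Metric.mem_closedBall, dist_comm]
    refine (dist_listCenter_le (fun v hv w hw => hd v (hkl.subset hv) w (hkl.subset hw))
      (hkk.subset hv)).trans ?_
    have : (0 : ℝ) < k.length := by exact_mod_cast List.length_pos_iff.2 hk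
    have : (k.length : ℝ) ≤ N := by exact_mod_cast hkl.length_le.trans hN
    gcongr

variable {ι : Type*} [Fintype ι]

/-- The face of the standard simplex spanned by the vertices in `U`. -/
def simplexFace (U : Finset ι) : Set (ι → ℝ) :=
  {z | z ∈ stdSimplex ℝ ι ∧ ∀ i ∉ U, z i = 0}

theorem convex_simplexFace (U : Finset ι) : Convex ℝ (simplexFace U) := by
  refine (convex_stdSimplex ℝ ι).inter (t := {z | ∀ i ∉ U, z i = 0}) ?_
  intro x hx y hy a b _ _ _ i hi
  simp [hx i hi, hy i hi]

theorem isCompact_simplexFace (U : Finset ι) : IsCompact (simplexFace U) := by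
  refine (isCompact_stdSimplex ℝ ι).inter_right (t := {z | ∀ i ∉ U, z i = 0}) ?_
  simp only [Set.ofPred_forall]
  exact isClosed_iInter fun i => isClosed_iInter fun _ =>
    isClosed_eq (continuous_apply i) continuous_const

theorem dist_le_one_of_mem_simplexFace {U : Finset ι} {v w : ι → ℝ} (hv : v ∈ simplexFace U)
    (hw : w ∈ simplexFace U) : dist v w ≤ 1 := by
  refine (dist_pi_le_iff zero_le_one).2 fun i => ?_
  have h1 := mem_Icc_of_mem_stdSimplex hv.1 i
  have h2 := mem_Icc_of_mem_stdSimplex hw.1 i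
  rw [Real.dist_eq, abs_le]
  constructor <;> linarith [h1.1, h1.2, h2.1, h2.2]

variable [DecidableEq ι]

/-- The barycenter of the face of the standard simplex spanned by `B`. -/
noncomputable def faceCenter (B : Finset ι) : ι → ℝ :=
  fun i => if i ∈ B then (B.card : ℝ)⁻¹ else 0

theorem faceCenter_mem {B U : Finset ι} (hB : B.Nonempty) (h : B ⊆ U) :
    faceCenter B ∈ simplexFace U := by
  have : (B.card : ℝ) ≠ 0 := by exact_mod_cast hB.card_pos.ne'
  refine ⟨⟨fun i => ?_, ?_⟩, fun i hi => ?_⟩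
  · unfold faceCenter
    split_ifs <;> positivity
  · simp [faceCenter, this]
  · exact if_neg fun hb => hi (h hb)

/-- The `n`-fold barycentric subdivision of (a subdivision of) a flag of faces. -/
noncomputable def flagSubdivision :
    ℕ → (List (Finset ι) →₀ ℤ) →ₗ[ℤ] (List (ι → ℝ) →₀ ℤ)
  | 0 => ListChain.subdivision fun k => faceCenter (k.toFinset.sup id)
  | n + 1 => ListChain.subdivision listCenter ∘ₗ flagSubdivision n

theorem boundary_flagSubdivision (n : ℕ) (x : List (Finset ι) →₀ ℤ) :
    ListChain.boundary (flagSubdivision n x) = flagSubdivision n (ListChain.boundary x) := by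
  induction n with
  | zero => exact ListChain.boundary_subdivision _ _
  | succ n ih => simp [flagSubdivision, ListChain.boundary_subdivision, ih]

theorem flagSubdivision_single_mem (n : ℕ) {N : ℕ} {U : Finset ι}
    {F : List (Finset ι)} (hN : F.length ≤ N) (hF : ∀ B ∈ F, B.Nonempty ∧ B ⊆ U) :
    flagSubdivision n (Finsupp.single F 1) ∈
      Finsupp.supported ℤ ℤ {m | m.length = F.length ∧ (∀ v ∈ m, v ∈ simplexFace U) ∧
        ∀ v ∈ m, ∀ w ∈ m, dist v w ≤ (1 - 1 / (N : ℝ)) ^ n} := by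
  induction n with
  | zero =>
    refine ListChain.supported_mono ?_ (ListChain.subdivision_single_mem _ F)
    rintro m ⟨h1, h2, -⟩
    have h4 : ∀ v ∈ m, v ∈ simplexFace U := by
      intro v hv
      obtain ⟨k, hk, hkl, rfl⟩ := h2 v hv
      refine faceCenter_mem ?_ ?_
      · obtain ⟨B, hB⟩ := List.exists_mem_of_ne_nil k hk
        exact (hF B (hkl.subset hB)).1.mono
          (Finset.le_sup (f := id) (List.mem_toFinset.2 hB))
      · exact Finset.sup_le fun B hB => (hF B (hkl.subset (List.mem_toFinset.1 hB))).2
    refine ⟨h1, h4, fun v hv w hw => ?_⟩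
    rw [pow_zero]
    exact dist_le_one_of_mem_simplexFace (h4 v hv) (h4 w hw)
  | succ n ih =>
    refine ListChain.map_mem_supported (ListChain.subdivision listCenter) (fun m hm => ?_) ih
    refine ListChain.supported_mono ?_ (subdivision_listCenter_mem (convex_simplexFace U)
      (hm.1.trans_le hN) hm.2.1 hm.2.2)
    rintro q ⟨h1, h2, h3⟩
    exact ⟨h1.trans hm.1, h2, by simpa only [pow_succ'] using h3⟩

end Geometry

section StrictFlags

variable {ι : Type*} [Fintype ι] [DecidableEq ι]

/-- All strictly decreasing flags of finite sets with members satisfying `P`. -/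
noncomputable def strictFlags (P : Finset ι → Prop) : Finset (List (Finset ι)) :=
  open Classical in
  (Finset.univ.map (Function.Embedding.subtype (List.Nodup (α := Finset ι)))).filter
    fun F => F.Pairwise (· > ·) ∧ ∀ B ∈ F, P B

theorem mem_strictFlags {P : Finset ι → Prop} {F : List (Finset ι)} :
    F ∈ strictFlags P ↔ F.Pairwise (· > ·) ∧ ∀ B ∈ F, P B := by
  simp only [strictFlags, Finset.mem_filter, Finset.mem_map, Finset.mem_univ, true_and,
    and_iff_right_iff_imp]
  exact fun h => ⟨⟨F, h.1.imp fun h => h.ne'⟩, rfl⟩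

theorem length_le_of_mem_strictFlags {P : Finset ι → Prop} {F : List (Finset ι)}
    (hF : F ∈ strictFlags P) : F.length ≤ Fintype.card (Finset ι) :=
  List.Nodup.length_le_card ((mem_strictFlags.1 hF).1.imp fun h => h.ne')

end StrictFlags

section Labels

variable {ι : Type*}

/-- The elements of `S` which are positive at some point of the list `l`. -/
noncomputable def positiveLabels (pos : (ι → ℝ) → ι → Prop) (S : Finset ι)
    (l : List (ι → ℝ)) : Finset ι :=
  open Classical in S.filter fun u => ∃ z ∈ l, pos z u

theorem mem_positiveLabels {pos : (ι → ℝ) → ι → Prop} {S : Finset ι} {l : List (ι → ℝ)}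
    {u : ι} : u ∈ positiveLabels pos S l ↔ u ∈ S ∧ ∃ z ∈ l, pos z u := by
  simp [positiveLabels]

end Labels

section Degrees

variable {ι : Type*} [Fintype ι] [DecidableEq ι]

/-- The signed number of simplices in the subdivision of the flag `F` that are labelled by `F`. -/
noncomputable def flagDegree (pos : (ι → ℝ) → ι → Prop) (S : Finset ι) (n : ℕ)
    (F : List (Finset ι)) : ℤ :=
  (-1) ^ F.length *
    ListChain.subdivision (positiveLabels pos S) (flagSubdivision n (Finsupp.single F 1)) F

theorem flagDegree_nil (pos : (ι → ℝ) → ι → Prop) (S : Finset ι) (n : ℕ) :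
    flagDegree pos S n [] = 1 := by
  have : ∀ n, flagSubdivision n (Finsupp.single ([] : List (Finset ι)) 1) =
      Finsupp.single [] 1 := by
    intro n
    induction n with
    | zero => simp [flagSubdivision]
    | succ n ih => simp [flagSubdivision, ih]
  simp [flagDegree, this]

/-- The degree of a flag in a proper face of `S` does not depend on `S`. -/
theorem flagDegree_eq_univ {pos : (ι → ℝ) → ι → Prop}
    (hpos : ∀ z u v, z u = 0 → z v = 0 → pos z u → pos z v) {S : Finset ι} (n : ℕ)
    {F : List (Finset ι)} (hF : F ∈ strictFlags fun B => B.Nonempty ∧ B ⊂ S) :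
    flagDegree pos S n F = flagDegree pos Finset.univ n F := by
  obtain _ | ⟨U, F⟩ := F
  · rw [flagDegree_nil, flagDegree_nil]
  have hF' := mem_strictFlags.1 hF
  have hsub : ∀ B ∈ U :: F, B.Nonempty ∧ B ⊆ U := by
    intro B hB
    refine ⟨(hF'.2 B hB).1, ?_⟩
    rcases List.mem_cons.1 hB with rfl | hB
    · exact subset_rfl
    · exact ((List.pairwise_cons.1 hF'.1).1 B hB).le
  obtain ⟨x, hxS, hxU⟩ := Finset.exists_of_ssubset (hF'.2 U (by simp)).2
  unfold flagDegree
  congr 1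
  refine ListChain.eq_of_mem_supported
    (Finsupp.lapply (U :: F) ∘ₗ ListChain.subdivision (positiveLabels pos S))
    (Finsupp.lapply (U :: F) ∘ₗ ListChain.subdivision (positiveLabels pos Finset.univ))
    (fun l hl => ?_) (flagSubdivision_single_mem n le_rfl hsub)
  have hlne : l ≠ [] := by
    rintro rfl
    simp at hl
  have hz : ∀ z ∈ l, ∀ u ∉ U, z u = 0 := fun z hz => (hl.2.1 z hz).2
  simp only [LinearMap.comp_apply, Finsupp.lapply_apply]
  by_cases hx : ∃ z ∈ l, pos z x
  · have key : ∀ S' : Finset ι, x ∈ S' →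
        ListChain.subdivision (positiveLabels pos S') (Finsupp.single l 1) (U :: F) = 0 := by
      intro S' hxS'
      rw [ListChain.subdivision_single _ hlne, ListChain.cone_apply_of_ne]
      intro m hm
      have : x ∈ positiveLabels pos S' l := mem_positiveLabels.2 ⟨hxS', hx⟩
      rw [← (List.cons.inj hm).1] at this
      exact hxU this
    rw [key S hxS, key _ (Finset.mem_univ x)]
  · rw [ListChain.subdivision_single_congr]
    intro k _ hkl
    ext u
    simp only [mem_positiveLabels, Finset.mem_univ, true_and, and_iff_right_iff_imp]
    rintro ⟨z, hzk, hzu⟩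
    have hzl := hkl.subset hzk
    by_contra huS
    have huU : u ∉ U := fun h => huS ((hF'.2 U (by simp)).2.subset h)
    exact hx ⟨z, hzl, hpos z u x (hz z hzl u huU) (hz z hzl x hxU) hzu⟩

/-- A labelling of fine subdivisions of the simplex on `S` by proper nonempty subsets of `S`
has vanishing Lefschetz number. -/
theorem sum_flagDegree_eq_zero {pos : (ι → ℝ) → ι → Prop} {S : Finset ι} (hS : S.Nonempty) {n : ℕ}
    (hne : ∀ z ∈ simplexFace S, ∃ u ∈ S, pos z u)
    (hsmall : ∀ l : List (ι → ℝ), l ≠ [] → (∀ z ∈ l, z ∈ simplexFace S) →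
      (∀ v ∈ l, ∀ w ∈ l, dist v w ≤ (1 - 1 / ((Fintype.card (Finset ι) + 1 : ℕ) : ℝ)) ^ n) →
      ∃ u ∈ S, ∀ z ∈ l, ¬ pos z u) :
    ∑ F ∈ strictFlags (fun B => B.Nonempty ∧ B ⊂ S), flagDegree pos S n F = 0 := by
  obtain ⟨T, hTdef⟩ : ∃ T, T =
      ListChain.subdivision (positiveLabels pos S) ∘ₗ flagSubdivision n := ⟨_, rfl⟩
  have hF : ∀ F, flagDegree pos S n F = (-1) ^ F.length * T (Finsupp.single F 1) F :=
    fun F => by rw [flagDegree, hTdef, LinearMap.comp_apply]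
  rw [Finset.sum_congr rfl fun F _ => hF F]
  refine ListChain.sum_trace_eq_zero {B | B.Nonempty ∧ B ⊂ S} _
    (fun F => mem_strictFlags (P := fun B => B.Nonempty ∧ B ⊂ S)) T
    (T ∘ₗ ListChain.cone S) (fun F _ => ?_) (fun F hF => ?_)
  · have hT : ∀ x, ListChain.boundary (T x) = T (ListChain.boundary x) := fun x => by
      simp [hTdef, ListChain.boundary_subdivision, boundary_flagSubdivision]
    rw [LinearMap.comp_apply, hT, ListChain.boundary_cone, map_sub, ListChain.boundary_single]
    simp
  · rw [LinearMap.comp_apply, ListChain.cone_single, hTdef, LinearMap.comp_apply]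
    have hmem : ∀ B ∈ S :: F, B.Nonempty ∧ B ⊆ S := by
      intro B hB
      rcases List.mem_cons.1 hB with rfl | hB
      · exact ⟨hS, subset_rfl⟩
      · exact ⟨((mem_strictFlags.1 hF).2 B hB).1, ((mem_strictFlags.1 hF).2 B hB).2.subset⟩
    have hlen : (S :: F).length ≤ Fintype.card (Finset ι) + 1 :=
      Nat.succ_le_succ (length_le_of_mem_strictFlags hF)
    have hflag := flagSubdivision_single_mem n hlen hmem
    refine ListChain.map_mem_supported (ListChain.subdivision (positiveLabels pos S))
      (fun l hl => ?_) hflag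
    refine ListChain.supported_mono ?_ (ListChain.subdivision_single_mem _ l)
    rintro G ⟨-, h2, h3⟩
    refine ⟨h3.imp ?_, fun B hB => ?_⟩
    · rintro _ _ ⟨k, k', -, -, hkk, -, rfl, rfl⟩ u hu
      obtain ⟨hu, z, hz, hzu⟩ := mem_positiveLabels.1 hu
      exact mem_positiveLabels.2 ⟨hu, z, hkk.subset hz, hzu⟩
    · obtain ⟨k, hk, hkl, rfl⟩ := h2 B hB
      constructor
      · obtain ⟨z, hz⟩ := List.exists_mem_of_ne_nil k hk
        obtain ⟨u, hu, hzu⟩ := hne z (hl.2.1 z (hkl.subset hz))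
        exact ⟨u, mem_positiveLabels.2 ⟨hu, z, hz, hzu⟩⟩
      · obtain ⟨u, hu, hzu⟩ := hsmall k hk (fun z hz => hl.2.1 z (hkl.subset hz))
          fun v hv w hw => hl.2.2 v (hkl.subset hv) w (hkl.subset hw)
        refine Finset.ssubset_iff_subset_ne.2
          ⟨fun x hx => (mem_positiveLabels.1 hx).1, fun h => ?_⟩
        rw [← h] at hu
        obtain ⟨-, z, hz, hz'⟩ := mem_positiveLabels.1 hu
        exact hzu z hz hz'

theorem dvd_choose_of_pos {p k m : ℕ} (hp : p.Prime) (hm : 0 < m) (hmk : m < p ^ k) :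
    p ∣ (p ^ k - 1 + m).choose m := by
  obtain ⟨m, rfl⟩ := Nat.exists_eq_succ_of_ne_zero hm.ne'
  have h := Nat.choose_succ_right_eq (p ^ k - 1 + (m + 1)) m
  have h' : p ^ k - 1 + (m + 1) - m = p ^ k := by omega
  rw [h'] at h
  by_contra hnd
  have hdvd : p ^ k ∣ m + 1 :=
    ((hp.coprime_iff_not_dvd.2 hnd).pow_left k).dvd_of_dvd_mul_left ⟨_, by rw [h, mul_comm]⟩
  exact absurd (Nat.le_of_dvd (Nat.succ_pos m) hdvd) (by omega)

theorem not_dvd_choose_two_mul_sub_one {p k : ℕ} (hp : p.Prime) :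
    ¬ p ∣ (2 * p ^ k - 1).choose (p ^ k) := by
  have hpos : 0 < p ^ k := pow_pos hp.pos k
  have e : 2 * p ^ k - 1 = p ^ k + (p ^ k - 1) := by omega
  rw [e, Nat.add_choose_eq, Finset.Nat.sum_antidiagonal_eq_sum_range_succ_mk,
    Finset.sum_range_succ]
  simp only [Nat.choose_self, Nat.sub_self, Nat.choose_zero_right, mul_one]
  rw [← Nat.dvd_add_iff_right]
  · exact hp.one_lt.ne' ∘ Nat.dvd_one.1
  · refine Finset.dvd_sum fun i hi => ?_
    rcases Nat.eq_zero_or_pos i with rfl | hi0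
    · simp [Nat.choose_eq_zero_of_lt (by omega : p ^ k - 1 < p ^ k)]
    · exact (hp.dvd_choose_pow hi0.ne' (Finset.mem_range.1 hi).ne).mul_right _

theorem dvd_card_ssupersets {p k : ℕ} (hp : p.Prime) (hι : Fintype.card ι = 2 * p ^ k - 1)
    {U : Finset ι} (hU : U.Nonempty) :
    p ∣ ((Finset.powersetCard (p ^ k) Finset.univ).filter (U ⊂ ·)).card := by
  by_cases h : U.card < p ^ k
  · have hcard : ((Finset.powersetCard (p ^ k) Finset.univ).filter (U ⊂ ·)).card =
        (Finset.powersetCard (p ^ k - U.card) Uᶜ).card := by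
      refine Finset.card_nbij' (· \ U) (· ∪ U) ?_ ?_ ?_ ?_
      · intro S hS
        simp only [Finset.coe_filter, Finset.mem_powersetCard, Finset.subset_univ, true_and,
          Set.mem_ofPred_eq, Finset.mem_coe] at hS ⊢
        refine ⟨fun x hx => by simpa using (Finset.mem_sdiff.1 hx).2, ?_⟩
        rw [Finset.card_sdiff_of_subset hS.2.subset, hS.1]
      · intro S hS
        simp only [Finset.coe_filter, Finset.mem_powersetCard, Finset.subset_univ, true_and,
          Set.mem_ofPred_eq, Finset.mem_coe] at hS ⊢
        have hd : Disjoint S U := Finset.subset_compl_iff_disjoint_right.1 hS.1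
        have hc : (S ∪ U).card = p ^ k := by
          rw [Finset.card_union_of_disjoint hd, hS.2]
          omega
        refine ⟨hc, Finset.ssubset_iff_subset_ne.2 ⟨Finset.subset_union_right, fun he => ?_⟩⟩
        rw [← he] at hc
        omega
      · intro S hS
        simp only [Finset.coe_filter, Set.mem_ofPred_eq] at hS
        exact Finset.sdiff_union_of_subset hS.2.subset
      · intro S hS
        have hd : Disjoint S U :=
          Finset.subset_compl_iff_disjoint_right.1 (Finset.mem_powersetCard.1 hS).1
        exact Finset.union_sdiff_cancel_right hd
    rw [hcard, Finset.card_powersetCard, Finset.card_compl, hι]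
    have h0 := hU.card_pos
    have := dvd_choose_of_pos (k := k) (m := p ^ k - U.card) hp (by omega) (by omega)
    convert this using 2
    omega
  · rw [Finset.card_eq_zero.2]
    · exact dvd_zero p
    · refine Finset.filter_eq_empty_iff.2 fun S hS hUS => h ?_
      rw [← (Finset.mem_powersetCard.1 hS).2]
      exact Finset.card_lt_card hUS

/-- The positivity pattern of the coordinates of a nowhere vanishing equivariant map cannot
exist when the number of rows is a prime power. -/
theorem false_of_positivity_pattern {p k : ℕ} (hp : p.Prime)
    (hι : Fintype.card ι = 2 * p ^ k - 1) {pos : (ι → ℝ) → ι → Prop}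
    (hpos : ∀ z u v, z u = 0 → z v = 0 → pos z u → pos z v)
    (hne : ∀ S : Finset ι, S.card = p ^ k → ∀ z ∈ simplexFace S, ∃ u ∈ S, pos z u)
    {ε : ℝ} (hε : 0 < ε)
    (hsmall : ∀ S : Finset ι, S.card = p ^ k → ∀ l : List (ι → ℝ), l ≠ [] →
      (∀ z ∈ l, z ∈ simplexFace S) → (∀ v ∈ l, ∀ w ∈ l, dist v w < ε) →
      ∃ u ∈ S, ∀ z ∈ l, ¬ pos z u) : False := by
  obtain ⟨n, hn⟩ : ∃ n : ℕ, (1 - 1 / ((Fintype.card (Finset ι) + 1 : ℕ) : ℝ)) ^ n < ε := by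
    refine exists_pow_lt_of_lt_one hε ?_
    have : (0 : ℝ) < 1 / ((Fintype.card (Finset ι) + 1 : ℕ) : ℝ) := by positivity
    linarith
  set 𝓢 := Finset.powersetCard (p ^ k) (Finset.univ : Finset ι) with h𝓢
  set A := strictFlags (fun B : Finset ι => B.Nonempty)
  have hS : ∀ S ∈ 𝓢, ∑ F ∈ A.filter (fun F => ∀ B ∈ F, B ⊂ S),
      flagDegree pos Finset.univ n F = 0 := by
    intro S hS
    have hc := (Finset.mem_powersetCard.1 hS).2
    have hA : A.filter (fun F => ∀ B ∈ F, B ⊂ S) =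
        strictFlags (fun B => B.Nonempty ∧ B ⊂ S) := by
      ext F
      simp only [A, Finset.mem_filter, mem_strictFlags]
      grind
    rw [hA, ← sum_flagDegree_eq_zero (pos := pos) (S := S) (n := n)
      (Finset.card_pos.1 (by rw [hc]; exact pow_pos hp.pos k)) (hne S hc)
      fun l hl hlS hd => hsmall S hc l hl hlS fun v hv w hw => (hd v hv w hw).trans_lt hn]
    exact Finset.sum_congr rfl fun F hF => (flagDegree_eq_univ hpos n hF).symm
  have hsum : ∑ F ∈ A, ((𝓢.filter fun S => ∀ B ∈ F, B ⊂ S).card : ℤ) *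
      flagDegree pos Finset.univ n F = 0 := by
    rw [← Finset.sum_eq_zero hS]
    simp only [Finset.sum_filter]
    rw [Finset.sum_comm]
    refine Finset.sum_congr rfl fun F _ => ?_
    rw [← Finset.sum_filter, Finset.sum_const, nsmul_eq_mul]
  have hnil : ([] : List (Finset ι)) ∈ A := mem_strictFlags.2 (by simp)
  rw [← Finset.add_sum_erase _ _ hnil, flagDegree_nil] at hsum
  have hd : (p : ℤ) ∣ ∑ F ∈ A.erase [], ((𝓢.filter fun S => ∀ B ∈ F, B ⊂ S).card : ℤ) *
      flagDegree pos Finset.univ n F := by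
    refine Finset.dvd_sum fun F hF => Dvd.dvd.mul_right ?_ _
    obtain ⟨hne, hF⟩ := Finset.mem_erase.1 hF
    obtain ⟨U, F, rfl⟩ := List.exists_cons_of_ne_nil hne
    obtain ⟨hF1, hF2⟩ := mem_strictFlags.1 hF
    rw [Int.natCast_dvd_natCast]
    convert dvd_card_ssupersets hp hι (hF2 U (by simp)) using 4 with S
    refine ⟨fun h => h U (by simp), fun h B hB => ?_⟩
    rcases List.mem_cons.1 hB with rfl | hB
    · exact h
    · exact lt_trans ((List.pairwise_cons.1 hF1).1 B hB) h
  refine not_dvd_choose_two_mul_sub_one (k := k) hp ?_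
  have h1 : (𝓢.filter fun S => ∀ B ∈ ([] : List (Finset ι)), B ⊂ S).card =
      (2 * p ^ k - 1).choose (p ^ k) := by
    simp [h𝓢, hι]
  rw [h1, mul_one] at hsum
  rw [← Int.natCast_dvd_natCast, eq_neg_of_add_eq_zero_left hsum]
  exact hd.neg_right

end Degrees

section Placements

variable {r m : ℕ}

/-- The matrix with column sums `z` whose nonzero entry in column `t` lies in row `π t`. -/
def placement (π : Fin m → Fin r) (z : Fin m → ℝ) : Fin r → Fin m → ℝ :=
  fun b t => if π t = b then z t else 0

theorem continuous_placement (π : Fin m → Fin r) : Continuous (placement π) := by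
  refine continuous_pi fun b => continuous_pi fun t => ?_
  unfold placement
  split_ifs
  · exact continuous_apply t
  · exact continuous_const

theorem placement_apply_ne_zero {π : Fin m → Fin r} {z : Fin m → ℝ} {b : Fin r} {t : Fin m} :
    placement π z b t ≠ 0 ↔ π t = b ∧ z t ≠ 0 := by
  simp [placement]

theorem placement_mem_confC2 {π : Fin (2 * r - 1) → Fin r} {z : Fin (2 * r - 1) → ℝ}
    (hz : z ∈ stdSimplex ℝ (Fin (2 * r - 1))) (hπ : Set.InjOn π {t | z t ≠ 0}) :
    placement π z ∈ ConfC2 r := by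
  refine ⟨fun b t => ?_, ?_, fun b t t' h h' => ?_, fun t b b' h h' => ?_⟩
  · unfold placement
    split_ifs
    · exact hz.1 t
    · exact le_rfl
  · rw [Finset.sum_comm, ← hz.2]
    simp [placement]
  · rw [placement_apply_ne_zero] at h h'
    exact hπ h.2 h'.2 (h.1.trans h'.1.symm)
  · rw [placement_apply_ne_zero] at h h'
    exact h.1.symm.trans h'.1

/-- Two placements of the same columns differ by a permutation of the rows, which can be
chosen to match two prescribed empty rows. -/
theorem exists_perm_placement {π π' : Fin m → Fin r} {s : Set (Fin m)} (hπ : Set.InjOn π s)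
    (hπ' : Set.InjOn π' s) {b b' : Fin r} (hb : (∃ u ∈ s, b = π u ∧ b' = π' u) ∨
      (b ∉ π '' s ∧ b' ∉ π' '' s)) :
    ∃ σ : Equiv.Perm (Fin r), (∀ t ∈ s, σ (π t) = π' t) ∧ σ b = b' := by
  classical
  obtain hempty | hne := isEmpty_or_nonempty (Fin m)
  · refine ⟨Equiv.swap b b', fun t => (hempty.false t).elim, Equiv.swap_apply_left b b'⟩
  set g : Fin r → Fin r := fun c => if c ∈ π '' s then π' (Function.invFunOn π s c) else b'
  have hg : ∀ t ∈ s, g (π t) = π' t := fun t ht => by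
    simp only [g, if_pos (Set.mem_image_of_mem π ht), hπ.leftInvOn_invFunOn ht]
  have hgb : g b = b' := by
    rcases hb with ⟨u, hu, rfl, rfl⟩ | h
    · exact hg u hu
    · simp only [g, if_neg h.1]
  have hinj : Set.InjOn g (insert b (π '' s)) := by
    have h1 : Set.InjOn g (π '' s) := by
      rintro _ ⟨t, ht, rfl⟩ _ ⟨t', ht', rfl⟩ h
      rw [hg t ht, hg t' ht'] at h
      rw [hπ' ht ht' h]
    rcases hb with ⟨u, hu, rfl, rfl⟩ | h
    · rwa [Set.insert_eq_of_mem (Set.mem_image_of_mem π hu)]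
    · refine (Set.injOn_insert h.1).2 ⟨h1, ?_⟩
      rintro ⟨_, ⟨t, ht, rfl⟩, he⟩
      rw [hg t ht, hgb] at he
      exact h.2 ⟨t, ht, he⟩
  obtain ⟨e, he⟩ := Set.MapsTo.exists_equiv_extend_of_card_eq (t := Finset.univ)
    (by simp) (fun _ _ => Finset.mem_coe.2 (Finset.mem_univ _)) hinj
  refine ⟨e.trans (Equiv.subtypeUnivEquiv Finset.mem_univ), fun t ht => ?_, ?_⟩
  · exact (he _ (Set.mem_insert_of_mem _ (Set.mem_image_of_mem π ht))).trans (hg t ht)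
  · exact (he _ (Set.mem_insert _ _)).trans hgb

theorem rowPerm_placement {π π' : Fin m → Fin r} {z : Fin m → ℝ} {σ : Equiv.Perm (Fin r)}
    (h : ∀ t, z t ≠ 0 → σ (π t) = π' t) :
    rowPerm σ (placement π z) = placement π' z := by
  ext b t
  by_cases hz : z t = 0
  · simp [rowPerm, placement, hz]
  · simp only [rowPerm, placement, ← h t hz, Equiv.Perm.eq_inv_iff_eq]

/-- An equivariant map takes the same value on corresponding rows of any two placements. -/
theorem equivariant_placement_eq
    {f : (Fin r → Fin (2 * r - 1) → ℝ) → (Fin r → ℝ)}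
    (hf : ∀ (σ : Equiv.Perm (Fin r)), ∀ M ∈ ConfC2 r, f (rowPerm σ M) = fun i => f M (σ⁻¹ i))
    {π π' : Fin (2 * r - 1) → Fin r} {z : Fin (2 * r - 1) → ℝ}
    (hz : z ∈ stdSimplex ℝ (Fin (2 * r - 1))) (hπ : Set.InjOn π {t | z t ≠ 0})
    (hπ' : Set.InjOn π' {t | z t ≠ 0}) {b b' : Fin r}
    (hb : (∃ u ∈ {t | z t ≠ 0}, b = π u ∧ b' = π' u) ∨
      (b ∉ π '' {t | z t ≠ 0} ∧ b' ∉ π' '' {t | z t ≠ 0})) :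
    f (placement π' z) b' = f (placement π z) b := by
  obtain ⟨σ, hσ, rfl⟩ := exists_perm_placement hπ hπ' hb
  rw [← rowPerm_placement hσ, hf σ _ (placement_mem_confC2 hz hπ)]
  simp

/-- Column `u` is positive at `z` if an equivariant map `f` is positive on the row of column
`u`, or on an empty row when `z u = 0`, in some placement of `z`. -/
def PositiveColumn (f : (Fin r → Fin m → ℝ) → (Fin r → ℝ)) (z : Fin m → ℝ) (u : Fin m) : Prop :=
  ∃ π : Fin m → Fin r, Set.InjOn π {t | z t ≠ 0} ∧
    ∃ b, (z u ≠ 0 → b = π u) ∧ (z u = 0 → b ∉ π '' {t | z t ≠ 0}) ∧ 0 < f (placement π z) b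

theorem support_subset_of_mem_simplexFace {S : Finset (Fin m)} {z : Fin m → ℝ}
    (hz : z ∈ simplexFace S) : {t | z t ≠ 0} ⊆ (S : Set (Fin m)) := fun t ht => by
  by_contra h
  exact ht (hz.2 t h)

theorem positiveColumn_iff
    {f : (Fin r → Fin (2 * r - 1) → ℝ) → (Fin r → ℝ)}
    (hf : ∀ (σ : Equiv.Perm (Fin r)), ∀ M ∈ ConfC2 r, f (rowPerm σ M) = fun i => f M (σ⁻¹ i))
    {S : Finset (Fin (2 * r - 1))} {π : Fin (2 * r - 1) → Fin r} (hπ : Set.InjOn π S)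
    {z : Fin (2 * r - 1) → ℝ} (hz : z ∈ simplexFace S) {u : Fin (2 * r - 1)} (hu : u ∈ S) :
    PositiveColumn f z u ↔ 0 < f (placement π z) (π u) := by
  have hsupp := support_subset_of_mem_simplexFace hz
  have hempty : z u = 0 → π u ∉ π '' {t | z t ≠ 0} := by
    rintro h ⟨t, ht, he⟩
    rw [hπ (hsupp ht) hu he] at ht
    exact ht h
  constructor
  · rintro ⟨π', hπ', b, h1, h2, h3⟩
    rwa [equivariant_placement_eq hf hz.1 hπ' (hπ.mono hsupp)]
    by_cases h : z u = 0
    · exact Or.inr ⟨h2 h, hempty h⟩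
    · exact Or.inl ⟨u, h, h1 h, rfl⟩
  · exact fun h => ⟨π, hπ.mono hsupp, π u, fun _ => rfl, hempty, h⟩

end Placements

/-- A nonzero vector with vanishing coordinate sum has coordinates of both signs. -/
theorem exists_pos_and_exists_neg_of_sum_eq_zero {ι : Type*} [Fintype ι] {y : ι → ℝ}
    (hy : ∑ i, y i = 0) (hy0 : y ≠ 0) : (∃ i, 0 < y i) ∧ ∃ i, y i < 0 := by
  obtain ⟨i, hi⟩ := Function.ne_iff.1 hy0
  constructor
  · by_contra! h
    exact hi ((Finset.sum_eq_zero_iff_of_nonpos fun i _ => h i).1 hy i (Finset.mem_univ i))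
  · by_contra! h
    exact hi ((Finset.sum_eq_zero_iff_of_nonneg fun i _ => h i).1 hy i (Finset.mem_univ i))

/-- Nonexistence of equivariant maps from `Δ_{r,2r-1}` to the sphere
`S^{r-2} = {y : Fin r → ℝ | ∑ i, y i = 0 ∧ ‖y‖ = 1}`, for `r` a prime
power. -/
theorem no_equivariant_map_C2_to_sphere (r : ℕ) (hr : IsPrimePow r) :
    ¬ ∃ f : (Fin r → Fin (2 * r - 1) → ℝ) → (Fin r → ℝ),
      ContinuousOn f (ConfC2 r) ∧
      (∀ M ∈ ConfC2 r, (∑ i, f M i) = 0 ∧ ‖f M‖ = 1) ∧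
      (∀ (σ : Equiv.Perm (Fin r)), ∀ M ∈ ConfC2 r,
        f (rowPerm σ M) = fun i => f M (σ⁻¹ i)) := by
  rintro ⟨f, hcont, hsphere, hequiv⟩
  obtain ⟨p, k, hp, -, hpk⟩ := hr
  have hsign : ∀ M ∈ ConfC2 r, (∃ i, 0 < f M i) ∧ ∃ i, f M i < 0 := fun M hM =>
    exists_pos_and_exists_neg_of_sum_eq_zero (hsphere M hM).1
      (norm_ne_zero_iff.1 (by rw [(hsphere M hM).2]; exact one_ne_zero))
  have hrows : ∀ S : Finset (Fin (2 * r - 1)), S.card = r →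
      ∃ π : Fin (2 * r - 1) → Fin r, Set.InjOn π S ∧ ∀ b, ∃ u ∈ S, π u = b := by
    intro S hS
    let e : S ≃ Fin r := S.equivFinOfCardEq hS
    have hr0 : Nonempty (Fin r) := ⟨⟨0, by rw [← hpk]; exact pow_pos hp.nat_prime.pos k⟩⟩
    refine ⟨fun u => if h : u ∈ S then e ⟨u, h⟩ else Classical.arbitrary _, ?_, fun b => ?_⟩
    · intro u hu v hv h
      have hu' : u ∈ S := hu
      have hv' : v ∈ S := hv
      simp only [hu', hv', dif_pos] at h
      exact congrArg Subtype.val (e.injective h)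
    · exact ⟨e.symm b, (e.symm b).2, by simp⟩
  have hmem : ∀ {S : Finset (Fin (2 * r - 1))} {π : Fin (2 * r - 1) → Fin r},
      Set.InjOn π S → ∀ z ∈ simplexFace S, placement π z ∈ ConfC2 r := fun hπ z hz =>
    placement_mem_confC2 hz.1 (hπ.mono (support_subset_of_mem_simplexFace hz))
  have hlebesgue : ∀ S : Finset (Fin (2 * r - 1)), ∃ ε > 0, S.card = r →
      ∀ l : List (Fin (2 * r - 1) → ℝ), l ≠ [] → (∀ z ∈ l, z ∈ simplexFace S) →
      (∀ v ∈ l, ∀ w ∈ l, dist v w < ε) → ∃ u ∈ S, ∀ z ∈ l, ¬ PositiveColumn f z u := by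
    intro S
    by_cases hS : S.card = r
    swap
    · exact ⟨1, one_pos, fun h => absurd h hS⟩
    obtain ⟨π, hπ, hsurj⟩ := hrows S hS
    have hg : ∀ b, ContinuousOn (fun z => f (placement π z) b) (simplexFace S) := fun b =>
      (continuous_apply b).comp_continuousOn
        (hcont.comp (continuous_placement π).continuousOn (hmem hπ))
    choose O hO hOeq using fun b => continuousOn_iff'.1 (hg b) (Set.Iio 0) isOpen_Iio
    have hOmem : ∀ z ∈ simplexFace S, ∀ b, z ∈ O b ↔ f (placement π z) b < 0 := fun z hz b => by
      simpa [hz] using (Set.ext_iff.1 (hOeq b) z).symm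
    obtain ⟨ε, hε, h⟩ := lebesgue_number_lemma_of_metric (isCompact_simplexFace S) hO
      fun z hz => by
        obtain ⟨b, hb⟩ := (hsign _ (hmem hπ z hz)).2
        exact Set.mem_iUnion.2 ⟨b, (hOmem z hz b).2 hb⟩
    refine ⟨ε, hε, fun _ l hl hlS hd => ?_⟩
    obtain ⟨w, hw⟩ := List.exists_mem_of_ne_nil l hl
    obtain ⟨b, hb⟩ := h w (hlS w hw)
    obtain ⟨u, hu, rfl⟩ := hsurj b
    refine ⟨u, hu, fun z hz => ?_⟩
    rw [positiveColumn_iff hequiv hπ (hlS z hz) hu]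
    exact ((hOmem z (hlS z hz) _).1 (hb (hd z hz w hw))).not_gt
  choose ε hε hsmall using hlebesgue
  obtain ⟨S₀, -, hS₀⟩ := Finset.exists_min_image Finset.univ ε Finset.univ_nonempty
  refine false_of_positivity_pattern (pos := PositiveColumn f) (k := k) hp.nat_prime
    (by rw [hpk, Fintype.card_fin]) ?_ ?_ (hε S₀) ?_
  · rintro z u v hu hv ⟨π, hπ, b, -, hb, hpos⟩
    exact ⟨π, hπ, b, fun h => absurd hv h, fun _ => hb hu, hpos⟩
  · intro S hS z hz
    obtain ⟨π, hπ, hsurj⟩ := hrows S (hS.trans hpk)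
    obtain ⟨b, hb⟩ := (hsign _ (hmem hπ z hz)).1
    obtain ⟨u, hu, rfl⟩ := hsurj b
    exact ⟨u, hu, (positiveColumn_iff hequiv hπ hz hu).2 hb⟩
  · intro S hS l hl hlS hd
    exact hsmall S (hS.trans hpk) l hl hlS fun v hv w hw =>
      (hd v hv w hw).trans_le (hS₀ S (Finset.mem_univ S))
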